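/- (Proposition 3, annihilation part: the map ρ preserves the ZF exchange relation among annihilation generators.) The elements α_i(k) = Σ_j (t_{ij}(k)a_j(k) + r_{ij}(k)a_j(−k)) satisfy, for all k₁,k₂ ∈ ℝ and indices i,j: α_i(k₁)α_j(k₂) = Σ_{p,q} [S₂₁(k₂,k₁)]^{(i,j)}_{(p,q)} α_q(k₂)α_p(k₁). -/

import Mathlib

open scoped Matrix BigOperators

variable {n : ℕ}

/-- `[S₂₁(k₂,k₁)]^{(i,j)}_{(p,q)} = [S(k₂,k₁)]^{(j,i)}_{(q,p)}`. -/
def S21 (S : ℝ → ℝ → Matrix (Fin n × Fin n) (Fin n × Fin n) ℂ) (k₂ k₁ : ℝ) :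
    Matrix (Fin n × Fin n) (Fin n × Fin n) ℂ :=
  Matrix.of fun x y => S k₂ k₁ (x.2, x.1) (y.2, y.1)

/-- `M₁ = M ⊗ Iₙ`. -/
def leg1 {A : Type*} [Semiring A] [DecidableEq (Fin n)]
    (M : Matrix (Fin n) (Fin n) A) :
    Matrix (Fin n × Fin n) (Fin n × Fin n) A :=
  Matrix.of fun x y => if x.2 = y.2 then M x.1 y.1 else 0

/-- `M₂ = Iₙ ⊗ M`. -/
def leg2 {A : Type*} [Semiring A] [DecidableEq (Fin n)]
    (M : Matrix (Fin n) (Fin n) A) :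
    Matrix (Fin n × Fin n) (Fin n × Fin n) A :=
  Matrix.of fun x y => if x.1 = y.1 then M x.2 y.2 else 0

/-- entrywise embedding of a scalar `n² × n²` matrix into matrices over `𝒜`. -/
def emb (𝒜 : Type*) [Ring 𝒜] [Algebra ℂ 𝒜]
    (M : Matrix (Fin n × Fin n) (Fin n × Fin n) ℂ) :
    Matrix (Fin n × Fin n) (Fin n × Fin n) 𝒜 :=
  M.map (algebraMap ℂ 𝒜)

/-- entrywise embedding of a scalar `n × n` matrix into matrices over `𝒜`. -/
def embn (𝒜 : Type*) [Ring 𝒜] [Algebra ℂ 𝒜] (M : Matrix (Fin n) (Fin n) ℂ) :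
    Matrix (Fin n) (Fin n) 𝒜 :=
  M.map (algebraMap ℂ 𝒜)

/-- `W₁₂` acting on factors 1,2 of `(ℂⁿ)^{⊗3}`. -/
def leg12 (W : Matrix (Fin n × Fin n) (Fin n × Fin n) ℂ) :
    Matrix (Fin n × Fin n × Fin n) (Fin n × Fin n × Fin n) ℂ :=
  Matrix.of fun x y => if x.2.2 = y.2.2 then W (x.1, x.2.1) (y.1, y.2.1) else 0

/-- `W₁₃` acting on factors 1,3 of `(ℂⁿ)^{⊗3}`. -/
def leg13 (W : Matrix (Fin n × Fin n) (Fin n × Fin n) ℂ) :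
    Matrix (Fin n × Fin n × Fin n) (Fin n × Fin n × Fin n) ℂ :=
  Matrix.of fun x y => if x.2.1 = y.2.1 then W (x.1, x.2.2) (y.1, y.2.2) else 0

/-- `W₂₃` acting on factors 2,3 of `(ℂⁿ)^{⊗3}`. -/
def leg23 (W : Matrix (Fin n × Fin n) (Fin n × Fin n) ℂ) :
    Matrix (Fin n × Fin n × Fin n) (Fin n × Fin n × Fin n) ℂ :=
  Matrix.of fun x y => if x.1 = y.1 then W (x.2.1, x.2.2) (y.2.1, y.2.2) else 0

section VectorLegs

variable {A : Type*} [Ring A]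

/-- The vector `u` placed in the first tensor factor, as a map `Aⁿ → Aⁿ ⊗ Aⁿ`. -/
def vecLeg1 (u : Fin n → A) : Matrix (Fin n × Fin n) (Fin n) A :=
  Matrix.of fun x y => if x.2 = y then u x.1 else 0

/-- The vector `u` placed in the second tensor factor, as a map `Aⁿ → Aⁿ ⊗ Aⁿ`. -/
def vecLeg2 (u : Fin n → A) : Matrix (Fin n × Fin n) (Fin n) A :=
  (vecLeg1 u).submatrix Prod.swap id

theorem vecLeg1_mul_apply (u : Fin n → A) (M : Matrix (Fin n) (Fin n) A) (i j l : Fin n) :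
    (vecLeg1 u * M) (i, j) l = u i * M j l := by
  simp [vecLeg1, Matrix.mul_apply]

theorem vecLeg1_mulVec_apply (u v : Fin n → A) (i j : Fin n) :
    (vecLeg1 u *ᵥ v) (i, j) = u i * v j := by
  simp [vecLeg1, Matrix.mulVec, dotProduct]

theorem vecLeg2_mulVec_apply (u v : Fin n → A) (i j : Fin n) :
    (vecLeg2 u *ᵥ v) (i, j) = u j * v i := by
  simp [vecLeg2, vecLeg1, Matrix.mulVec, dotProduct]

theorem vecLeg2_mul (u : Fin n → A) (M : Matrix (Fin n) (Fin n) A) :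
    vecLeg2 u * M = (vecLeg1 u * M).submatrix Prod.swap id := rfl

theorem vecLeg1_add (u v : Fin n → A) : vecLeg1 (u + v) = vecLeg1 u + vecLeg1 v := by
  ext x y
  by_cases h : x.2 = y <;> simp [vecLeg1, h]

theorem vecLeg2_add (u v : Fin n → A) : vecLeg2 (u + v) = vecLeg2 u + vecLeg2 v := by
  simp [vecLeg2, vecLeg1_add, Matrix.submatrix_add]

theorem leg1_mul_vecLeg1 (M : Matrix (Fin n) (Fin n) A) (u : Fin n → A) :
    leg1 M * vecLeg1 u = vecLeg1 (M *ᵥ u) := by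
  ext ⟨i, j⟩ l
  by_cases h : j = l <;>
    simp [leg1, vecLeg1, Matrix.mul_apply, Matrix.mulVec, dotProduct, Fintype.sum_prod_type, h]

theorem leg2_submatrix_swap (M : Matrix (Fin n) (Fin n) A) :
    (leg2 M).submatrix Prod.swap Prod.swap = leg1 M := rfl

theorem leg1_submatrix_swap (M : Matrix (Fin n) (Fin n) A) :
    (leg1 M).submatrix Prod.swap Prod.swap = leg2 M := rfl

theorem submatrix_swap_mul {m : Type*} (f : m → m)
    (M : Matrix (Fin n × Fin n) (Fin n × Fin n) A) (N : Matrix (Fin n × Fin n) m A) :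
    (M * N).submatrix Prod.swap f =
      M.submatrix Prod.swap Prod.swap * N.submatrix Prod.swap f :=
  (Matrix.submatrix_mul_equiv M N Prod.swap (Equiv.prodComm _ _) f).symm

theorem leg2_mul_vecLeg2 (M : Matrix (Fin n) (Fin n) A) (u : Fin n → A) :
    leg2 M * vecLeg2 u = vecLeg2 (M *ᵥ u) := by
  rw [vecLeg2, ← leg1_submatrix_swap, ← submatrix_swap_mul, leg1_mul_vecLeg1, vecLeg2]

/-- Products of dressed vectors `X u` and `Y v` are exchanged by `B`, provided that
`u` and `v` are exchanged by `E`, that they are moved through `Y` and `X` by conjugation, and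
that `X` and `Y` satisfy the reflection-type relation `hXY`. -/
theorem vecLeg1_mulVec_exchange {X Y : Matrix (Fin n) (Fin n) A} {u v : Fin n → A}
    {B P C D E F : Matrix (Fin n × Fin n) (Fin n × Fin n) A}
    (hBP : B * P = 1) (hDE : D * E = 1)
    (huv : vecLeg1 u *ᵥ v = E *ᵥ (vecLeg2 v *ᵥ u))
    (huY : vecLeg1 u * Y = C * leg2 Y * D * vecLeg1 u)
    (hvX : vecLeg2 v * X = F * leg1 X * E * vecLeg2 v)
    (hXY : P * leg1 X * C * leg2 Y = leg2 Y * F * leg1 X * E) :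
    vecLeg1 (X *ᵥ u) *ᵥ (Y *ᵥ v) = B *ᵥ (vecLeg2 (Y *ᵥ v) *ᵥ (X *ᵥ u)) := by
  have hXCY : leg1 X * C * leg2 Y = B * (leg2 Y * F * leg1 X * E) := by
    rw [← hXY]
    simp only [Matrix.mul_assoc]
    rw [← Matrix.mul_assoc B P, hBP, Matrix.one_mul]
  calc vecLeg1 (X *ᵥ u) *ᵥ (Y *ᵥ v)
      = (leg1 X * (vecLeg1 u * Y)) *ᵥ v := by
        rw [← leg1_mul_vecLeg1, Matrix.mulVec_mulVec, Matrix.mul_assoc]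
    _ = (leg1 X * C * leg2 Y * D) *ᵥ (vecLeg1 u *ᵥ v) := by
        rw [huY, Matrix.mulVec_mulVec]
        simp only [Matrix.mul_assoc]
    _ = (leg1 X * C * leg2 Y * (D * E)) *ᵥ (vecLeg2 v *ᵥ u) := by
        rw [huv, Matrix.mulVec_mulVec, Matrix.mul_assoc _ D E]
    _ = (B * (leg2 Y * F * leg1 X * E)) *ᵥ (vecLeg2 v *ᵥ u) := by
        rw [hDE, Matrix.mul_one, hXCY]
    _ = (B * (leg2 Y * (vecLeg2 v * X))) *ᵥ u := by
        rw [hvX, Matrix.mulVec_mulVec]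
        simp only [Matrix.mul_assoc]
    _ = B *ᵥ (vecLeg2 (Y *ᵥ v) *ᵥ (X *ᵥ u)) := by
        rw [← leg2_mul_vecLeg2]
        simp only [Matrix.mulVec_mulVec, Matrix.mul_assoc]

end VectorLegs

theorem S21_S21 (S : ℝ → ℝ → Matrix (Fin n × Fin n) (Fin n × Fin n) ℂ) : S21 (S21 S) = S := rfl

section ScalarMatrices

variable {𝒜 : Type*} [Ring 𝒜] [Algebra ℂ 𝒜]

theorem emb_mul (M N : Matrix (Fin n × Fin n) (Fin n × Fin n) ℂ) :
    emb 𝒜 (M * N) = emb 𝒜 M * emb 𝒜 N :=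
  Matrix.map_mul

theorem emb_one : emb 𝒜 (1 : Matrix (Fin n × Fin n) (Fin n × Fin n) ℂ) = 1 :=
  Matrix.map_one _ (map_zero _) (map_one _)

theorem emb_submatrix_swap (S : ℝ → ℝ → Matrix (Fin n × Fin n) (Fin n × Fin n) ℂ) (k l : ℝ) :
    (emb 𝒜 (S k l)).submatrix Prod.swap Prod.swap = emb 𝒜 (S21 S k l) := rfl

theorem emb_mulVec_apply (M : Matrix (Fin n × Fin n) (Fin n × Fin n) ℂ)
    (w : Fin n × Fin n → 𝒜) (x : Fin n × Fin n) :
    (emb 𝒜 M *ᵥ w) x = ∑ p, ∑ q, M x (p, q) • w (p, q) := by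
  simp [emb, Matrix.mulVec, dotProduct, Fintype.sum_prod_type, Algebra.smul_def]

theorem emb_mul_leg2_mul_emb_mul_vecLeg1_apply
    (W Z : Matrix (Fin n × Fin n) (Fin n × Fin n) ℂ) (Y : Matrix (Fin n) (Fin n) 𝒜)
    (u : Fin n → 𝒜) (x : Fin n × Fin n) (l : Fin n) :
    (emb 𝒜 W * leg2 Y * emb 𝒜 Z * vecLeg1 u) x l =
      ∑ q, ∑ p, ∑ s, ∑ m, (W x (p, q) * Z (p, s) (m, l)) • (Y q s * u m) := by
  have hW (z : Fin n × Fin n) : (emb 𝒜 W * leg2 Y) x z = ∑ q, W x (z.1, q) • Y q z.2 := by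
    simp [emb, leg2, Matrix.mul_apply, Fintype.sum_prod_type, Algebra.smul_def]
  have hZ (z : Fin n × Fin n) : (emb 𝒜 Z * vecLeg1 u) z l = ∑ m, Z z (m, l) • u m := by
    simp [emb, vecLeg1, Matrix.mul_apply, Fintype.sum_prod_type, Algebra.smul_def]
  rw [Matrix.mul_assoc, Matrix.mul_apply, Fintype.sum_prod_type]
  simp only [hW, hZ, Finset.sum_mul_sum, smul_mul_smul_comm]
  exact (Finset.sum_congr rfl fun p _ => Finset.sum_comm).trans Finset.sum_comm

end ScalarMatrices

theorem stmt_9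
    (hn : 1 ≤ n)
    (S : ℝ → ℝ → Matrix (Fin n × Fin n) (Fin n × Fin n) ℂ)
    (hU : ∀ k₁ k₂, S k₁ k₂ * S21 S k₂ k₁ = 1)
    (hYB : ∀ k₁ k₂ k₃,
      leg12 (S k₁ k₂) * leg13 (S k₁ k₃) * leg23 (S k₂ k₃) =
        leg23 (S k₂ k₃) * leg13 (S k₁ k₃) * leg12 (S k₁ k₂))
    (𝒜 : Type*) [Ring 𝒜] [Algebra ℂ 𝒜]
    (a ad : ℝ → Fin n → 𝒜)
    (t r : ℝ → Matrix (Fin n) (Fin n) 𝒜)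
    (hZF1 : ∀ k₁ k₂ (i j : Fin n), a k₁ i * a k₂ j =
      ∑ p, ∑ q, S21 S k₂ k₁ (i, j) (p, q) • (a k₂ q * a k₁ p))
    (hZF2 : ∀ k₁ k₂ (i j : Fin n), ad k₁ i * ad k₂ j =
      ∑ p, ∑ q, S21 S k₂ k₁ (p, q) (i, j) • (ad k₂ q * ad k₁ p))
    (hE1 : ∀ k₁ k₂ (i j l : Fin n), a k₁ i * t k₂ j l =
      ∑ q, ∑ r', ∑ s, ∑ m,
        (S21 S k₂ k₁ (i, j) (r', q) * S k₁ k₂ (r', s) (m, l)) • (t k₂ q s * a k₁ m))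
    (hE2 : ∀ k₁ k₂ (i j l : Fin n), a k₁ i * r k₂ j l =
      ∑ q, ∑ r', ∑ s, ∑ m,
        (S21 S k₂ k₁ (i, j) (r', q) * S k₁ (-k₂) (r', s) (m, l)) • (r k₂ q s * a k₁ m))
    (hE3 : ∀ k₁ k₂ (i l j : Fin n), t k₁ i l * ad k₂ j =
      ∑ p, ∑ q, ∑ r', ∑ s,
        (S k₁ k₂ (i, p) (q, r') * S21 S k₂ k₁ (s, r') (l, j)) • (ad k₂ p * t k₁ q s))
    (hE4 : ∀ k₁ k₂ (i l j : Fin n), r k₁ i l * ad k₂ j =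
      ∑ p, ∑ q, ∑ r', ∑ s,
        (S k₁ k₂ (i, p) (q, r') * S21 S k₂ (-k₁) (s, r') (l, j)) • (ad k₂ p * r k₁ q s))
    (hE5 : ∀ k₁ k₂,
      emb 𝒜 (S k₁ k₂) * leg1 (t k₁) * emb 𝒜 (S21 S k₂ k₁) * leg2 (t k₂) =
        leg2 (t k₂) * emb 𝒜 (S k₁ k₂) * leg1 (t k₁) * emb 𝒜 (S21 S k₂ k₁))
    (hE6 : ∀ k₁ k₂,
      emb 𝒜 (S k₁ k₂) * leg1 (t k₁) * emb 𝒜 (S21 S k₂ k₁) * leg2 (r k₂) =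
        leg2 (r k₂) * emb 𝒜 (S k₁ (-k₂)) * leg1 (t k₁) * emb 𝒜 (S21 S (-k₂) k₁))
    (hE7 : ∀ k₁ k₂,
      emb 𝒜 (S k₁ k₂) * leg1 (r k₁) * emb 𝒜 (S21 S k₂ (-k₁)) * leg2 (r k₂) =
        leg2 (r k₂) * emb 𝒜 (S k₁ (-k₂)) * leg1 (r k₁) * emb 𝒜 (S21 S (-k₂) (-k₁)))
    (hE8 : ∀ k, t k * t k + r k * r (-k) = 1)
    (hE9 : ∀ k, t k * r k + r k * t (-k) = 0)
    (al ald A Ad : ℝ → Fin n → 𝒜)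
    (hal : ∀ k (i : Fin n), al k i = ∑ j, (t k i j * a k j + r k i j * a (-k) j))
    (hald : ∀ k (i : Fin n), ald k i = ∑ j, (ad k j * t k j i + ad (-k) j * r (-k) j i))
    (hA : ∀ k (i : Fin n), A k i = (2 : ℂ)⁻¹ • (a k i + al k i))
    (hAd : ∀ k (i : Fin n), Ad k i = (2 : ℂ)⁻¹ • (ad k i + ald k i))
    :
    ∀ k₁ k₂ (i j : Fin n),
      al k₁ i * al k₂ j = ∑ p, ∑ q, S21 S k₂ k₁ (i, j) (p, q) • (al k₂ q * al k₁ p) := by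
  have hU' (k l : ℝ) : S21 S l k * S k l = 1 := mul_eq_one_comm.mp (hU k l)
  have eU (k l : ℝ) : emb 𝒜 (S k l) * emb 𝒜 (S21 S l k) = 1 := by
    rw [← emb_mul, hU, emb_one]
  have eU' (k l : ℝ) : emb 𝒜 (S21 S l k) * emb 𝒜 (S k l) = 1 := by
    rw [← emb_mul, hU', emb_one]
  have hZF (k l : ℝ) : vecLeg1 (a k) *ᵥ a l =
      emb 𝒜 (S21 S l k) *ᵥ (vecLeg2 (a l) *ᵥ a k) := by
    ext ⟨i, j⟩
    simp only [vecLeg1_mulVec_apply, emb_mulVec_apply, vecLeg2_mulVec_apply, hZF1 k l i j]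
  have ht (k l : ℝ) : vecLeg1 (a k) * t l =
      emb 𝒜 (S21 S l k) * leg2 (t l) * emb 𝒜 (S k l) * vecLeg1 (a k) := by
    ext ⟨i, j⟩ m
    rw [vecLeg1_mul_apply, emb_mul_leg2_mul_emb_mul_vecLeg1_apply, hE1]
  have hr (k l : ℝ) : vecLeg1 (a k) * r l =
      emb 𝒜 (S21 S l k) * leg2 (r l) * emb 𝒜 (S k (-l)) * vecLeg1 (a k) := by
    ext ⟨i, j⟩ m
    rw [vecLeg1_mul_apply, emb_mul_leg2_mul_emb_mul_vecLeg1_apply, hE2]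
  have ht' (k l : ℝ) : vecLeg2 (a k) * t l =
      emb 𝒜 (S l k) * leg1 (t l) * emb 𝒜 (S21 S k l) * vecLeg2 (a k) := by
    rw [vecLeg2_mul, ht]
    simp only [submatrix_swap_mul, leg2_submatrix_swap, emb_submatrix_swap, S21_S21, vecLeg2]
  have hr' (k l : ℝ) : vecLeg2 (a k) * r l =
      emb 𝒜 (S l k) * leg1 (r l) * emb 𝒜 (S21 S k (-l)) * vecLeg2 (a k) := by
    rw [vecLeg2_mul, hr]
    simp only [submatrix_swap_mul, leg2_submatrix_swap, emb_submatrix_swap, S21_S21, vecLeg2]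
  have hrt (k l : ℝ) :
      emb 𝒜 (S k l) * leg1 (r k) * emb 𝒜 (S21 S l (-k)) * leg2 (t l) =
        leg2 (t l) * emb 𝒜 (S k l) * leg1 (r k) * emb 𝒜 (S21 S l (-k)) := by
    have h : emb 𝒜 (S21 S l k) * leg2 (t l) * emb 𝒜 (S k l) * leg1 (r k) =
        leg1 (r k) * emb 𝒜 (S21 S l (-k)) * leg2 (t l) * emb 𝒜 (S (-k) l) := by
      have h := congrArg (fun M => M.submatrix Prod.swap Prod.swap) (hE6 l k)
      simpa only [Matrix.mul_assoc, submatrix_swap_mul, leg1_submatrix_swap,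
        leg2_submatrix_swap, emb_submatrix_swap, S21_S21] using h
    calc emb 𝒜 (S k l) * leg1 (r k) * emb 𝒜 (S21 S l (-k)) * leg2 (t l)
        = emb 𝒜 (S k l) * (leg1 (r k) * emb 𝒜 (S21 S l (-k)) * leg2 (t l) *
            emb 𝒜 (S (-k) l)) * emb 𝒜 (S21 S l (-k)) := by
          simp only [Matrix.mul_assoc, eU, Matrix.mul_one]
      _ = (emb 𝒜 (S k l) * emb 𝒜 (S21 S l k)) * leg2 (t l) * emb 𝒜 (S k l) * leg1 (r k) *
            emb 𝒜 (S21 S l (-k)) := by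
          rw [← h]
          simp only [Matrix.mul_assoc]
      _ = _ := by rw [eU, Matrix.one_mul]
  have hal' (k : ℝ) : al k = t k *ᵥ a k + r k *ᵥ a (-k) := by
    ext i
    simp [hal, Matrix.mulVec, dotProduct, Finset.sum_add_distrib]
  intro k₁ k₂ i j
  have key : vecLeg1 (al k₁) *ᵥ al k₂ =
      emb 𝒜 (S21 S k₂ k₁) *ᵥ (vecLeg2 (al k₂) *ᵥ al k₁) := by
    have htt := vecLeg1_mulVec_exchange (eU' k₁ k₂) (eU k₁ k₂) (hZF k₁ k₂)
      (ht k₁ k₂) (ht' k₂ k₁) (hE5 k₁ k₂)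
    have htr := vecLeg1_mulVec_exchange (eU' k₁ k₂) (eU k₁ (-k₂)) (hZF k₁ (-k₂))
      (hr k₁ k₂) (ht' (-k₂) k₁) (hE6 k₁ k₂)
    have hrt := vecLeg1_mulVec_exchange (eU' k₁ k₂) (eU (-k₁) k₂) (hZF (-k₁) k₂)
      (ht (-k₁) k₂) (hr' k₂ k₁) (hrt k₁ k₂)
    have hrr := vecLeg1_mulVec_exchange (eU' k₁ k₂) (eU (-k₁) (-k₂)) (hZF (-k₁) (-k₂))
      (hr (-k₁) k₂) (hr' (-k₂) k₁) (hE7 k₁ k₂)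
    simp only [hal', vecLeg1_add, vecLeg2_add, Matrix.add_mulVec, Matrix.mulVec_add,
      htt, htr, hrt, hrr]
    abel
  have h := congrFun key (i, j)
  simpa only [vecLeg1_mulVec_apply, emb_mulVec_apply, vecLeg2_mulVec_apply] using h
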